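/- Let V₁, V₂, V₃ ⊆ k⁴ be 2-dimensional linear subspaces with V_i ∩ V_j = {0} for i ≠ j, and let w₀, w₁, w₂, w₃ ∈ k⁴ be nonzero vectors that span k⁴. Assume that for each l ∈ {1,2,3}, the only homogeneous polynomial of degree 2 vanishing on both subspaces V_p with p ≠ l and at all four vectors w₀, …, w₃ is the zero polynomial. Then for every choice of scalars c₀, c₁, c₂, c₃ ∈ k there exists a homogeneous polynomial F of degree 3 vanishing on V₁ ∪ V₂ ∪ V₃ such that F(w_i) = c_i for i = 0, 1, 2, 3 (i.e., the restriction map H⁰(I_Y(3)) → H⁰(O_W(3)) is surjective, where Y = L₁ ∪ L₂ ∪ L₃ and W = {P₀, …, P₃}). -/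

import Mathlib

open MvPolynomial

/-- The homogeneous polynomial of degree one attached to a linear functional on `σ → k`. -/
noncomputable def linearFormPoly {σ k : Type*} [Fintype σ] [DecidableEq σ] [CommSemiring k]
    (φ : (σ → k) →ₗ[k] k) : MvPolynomial σ k :=
  ∑ i, C (φ (Pi.single i 1)) * X i

theorem isHomogeneous_linearFormPoly {σ k : Type*} [Fintype σ] [DecidableEq σ] [CommSemiring k]
    (φ : (σ → k) →ₗ[k] k) : (linearFormPoly φ).IsHomogeneous 1 :=
  IsHomogeneous.sum _ _ _ fun i _ => isHomogeneous_C_mul_X _ i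

theorem eval_linearFormPoly {σ k : Type*} [Fintype σ] [DecidableEq σ] [CommSemiring k]
    (φ : (σ → k) →ₗ[k] k) (v : σ → k) : eval v (linearFormPoly φ) = φ v := by
  rw [LinearMap.pi_apply_eq_sum_univ φ v]
  simp only [linearFormPoly, map_sum, map_mul, eval_C, eval_X, smul_eq_mul]
  refine Finset.sum_congr rfl fun i _ => ?_
  rw [mul_comm]
  congr 3
  ext j
  simp [Pi.single_apply, eq_comm]

/-- If no nonzero quadric contains two complementary lines and four given points, then the
quadrics containing the two lines take arbitrary values at the four points. -/
theorem exists_quadric_eval_eq {k : Type*} [Field k] (U V : Submodule k (Fin 4 → k))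
    (hU : Module.finrank k U = 2) (hV : Module.finrank k V = 2) (hUV : IsCompl U V)
    (w : Fin 4 → Fin 4 → k)
    (hw : ∀ q : MvPolynomial (Fin 4) k, q.IsHomogeneous 2 →
      (∀ v ∈ U, eval v q = 0) → (∀ v ∈ V, eval v q = 0) → (∀ i, eval (w i) q = 0) → q = 0)
    (c : Fin 4 → k) :
    ∃ q : MvPolynomial (Fin 4) k, q.IsHomogeneous 2 ∧
      (∀ v ∈ U, eval v q = 0) ∧ (∀ v ∈ V, eval v q = 0) ∧ ∀ i, eval (w i) q = c i := by
  let bU := Module.finBasisOfFinrankEq k U hU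
  let bV := Module.finBasisOfFinrankEq k V hV
  let y (i : Fin 2) : (Fin 4 → k) →ₗ[k] k := bU.coord i ∘ₗ U.projectionOnto V hUV
  let z (j : Fin 2) : (Fin 4 → k) →ₗ[k] k := bV.coord j ∘ₗ V.projectionOnto U hUV.symm
  have hyV (i) (v) (hv : v ∈ V) : y i v = 0 := by
    simp [y, (Submodule.projectionOnto_apply_eq_zero_iff hUV).2 hv]
  have hzU (j) (v) (hv : v ∈ U) : z j v = 0 := by
    simp [z, (Submodule.projectionOnto_apply_eq_zero_iff hUV.symm).2 hv]
  have hyU (i a) : y i (bU a) = if a = i then 1 else 0 := by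
    simp [y, Finsupp.single_apply]
  have hzV (j b) : z j (bV b) = if b = j then 1 else 0 := by
    simp [z, Finsupp.single_apply]
  let T : (Fin 2 × Fin 2 → k) →ₗ[k] MvPolynomial (Fin 4) k :=
    Fintype.linearCombination k fun s => linearFormPoly (y s.1) * linearFormPoly (z s.2)
  have hT (d : Fin 2 × Fin 2 → k) (v) : eval v (T d) = ∑ s, d s * (y s.1 v * z s.2 v) := by
    simp [T, Fintype.linearCombination_apply, smul_eval, eval_linearFormPoly]
  have hThom (d) : (T d).IsHomogeneous 2 := by
    simp only [T, Fintype.linearCombination_apply]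
    refine IsHomogeneous.sum _ _ _ fun s _ => ?_
    rw [smul_eq_C_mul]
    exact ((isHomogeneous_linearFormPoly _).mul (isHomogeneous_linearFormPoly _)).C_mul _
  have hTU (d) (v) (hv : v ∈ U) : eval v (T d) = 0 := by simp [hT, hzU _ v hv]
  have hTV (d) (v) (hv : v ∈ V) : eval v (T d) = 0 := by simp [hT, hyV _ v hv]
  let E : (Fin 2 × Fin 2 → k) →ₗ[k] (Fin 4 → k) :=
    LinearMap.pi fun i => (aeval (w i)).toLinearMap ∘ₗ T
  have hE (d i) : E d i = eval (w i) (T d) := by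
    simp [E]
  have hinj : Function.Injective E := by
    rw [injective_iff_map_eq_zero]
    intro d hd
    have h0 : T d = 0 := hw _ (hThom d) (hTU d) (hTV d) fun i => by rw [← hE, hd, Pi.zero_apply]
    ext ⟨a, b⟩
    have h1 := hT d (bU a + bV b)
    have hy (i) : y i (bU a + bV b) = if a = i then 1 else 0 := by
      rw [map_add, hyU, hyV _ _ (bV b).2, add_zero]
    have hz (j) : z j (bU a + bV b) = if b = j then 1 else 0 := by
      rw [map_add, hzV, hzU _ _ (bU a).2, zero_add]
    simpa [h0, hy, hz, Fintype.sum_prod_type] using h1.symm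
  have hsurj : Function.Surjective E :=
    (LinearMap.injective_iff_surjective_of_finrank_eq_finrank (by simp)).1 hinj
  obtain ⟨d, hd⟩ := hsurj c
  exact ⟨T d, hThom d, hTU d, hTV d, fun i => by rw [← hE, hd]⟩

/-- The restriction map `H⁰(I_Y(3)) → H⁰(O_W(3))` is surjective, where `Y` is the
union of three mutually disjoint lines and `W` consists of four points not in a
plane imposing independent conditions on quadrics through two of the lines. -/
theorem stmt_4 {k : Type*} [Field k] [IsAlgClosed k] [CharZero k]
    (V : Fin 3 → Submodule k (Fin 4 → k))
    (hVdim : ∀ p, Module.finrank k (V p) = 2)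
    (hVdisj : ∀ p q : Fin 3, p ≠ q → V p ⊓ V q = ⊥)
    (w : Fin 4 → (Fin 4 → k))
    (hw0 : ∀ i, w i ≠ 0)
    (hwspan : Submodule.span k (Set.range w) = ⊤)
    (hres : ∀ l : Fin 3, ∀ q : MvPolynomial (Fin 4) k, q.IsHomogeneous 2 →
      (∀ p : Fin 3, p ≠ l → ∀ v ∈ V p, eval v q = 0) →
      (∀ i, eval (w i) q = 0) → q = 0) :
    ∀ c : Fin 4 → k, ∃ F : MvPolynomial (Fin 4) k, F.IsHomogeneous 3 ∧
      (∀ p : Fin 3, ∀ v ∈ V p, eval v F = 0) ∧ ∀ i, eval (w i) F = c i := by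
  have hcompl (p q : Fin 3) (hpq : p ≠ q) : IsCompl (V p) (V q) := by
    rw [Submodule.isCompl_iff_disjoint _ _ (by simp [hVdim]), disjoint_iff]
    exact hVdisj p q hpq
  have hpoint (i : Fin 4) : ∃ F : MvPolynomial (Fin 4) k, F.IsHomogeneous 3 ∧
      (∀ p : Fin 3, ∀ v ∈ V p, eval v F = 0) ∧
      ∀ j, eval (w j) F = (Pi.single i 1 : Fin 4 → k) j := by
    obtain ⟨l, hl⟩ : ∃ l, w i ∉ V l := by
      by_contra! h
      exact hw0 i (by simpa [hVdisj 0 1 (by decide)] using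
        Submodule.mem_inf.2 ⟨h 0, h 1⟩)
    obtain ⟨φ, hφw, hφV⟩ := Submodule.exists_le_ker_of_notMem hl
    obtain ⟨p, q, hpl, hql, hpq, hall⟩ :
        ∃ p q : Fin 3, p ≠ l ∧ q ≠ l ∧ p ≠ q ∧ ∀ r, r ≠ l → r = p ∨ r = q := by
      clear hl hφV
      revert l
      decide
    obtain ⟨Q, hQ, hQp, hQq, hQw⟩ := exists_quadric_eval_eq (V p) (V q) (hVdim p) (hVdim q)
      (hcompl p q hpq) w (fun Q hQ hp hq => hres l Q hQ fun r hr => by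
        rcases hall r hr with rfl | rfl <;> assumption) (Pi.single i (φ (w i))⁻¹)
    refine ⟨linearFormPoly φ * Q, (isHomogeneous_linearFormPoly φ).mul hQ, fun r v hv => ?_,
      fun j => ?_⟩
    · rw [map_mul, eval_linearFormPoly]
      by_cases hr : r = l
      · subst hr
        rw [LinearMap.mem_ker.1 (hφV hv), zero_mul]
      · rcases hall r hr with rfl | rfl
        · rw [hQp v hv, mul_zero]
        · rw [hQq v hv, mul_zero]
    · rw [map_mul, eval_linearFormPoly, hQw]
      rcases eq_or_ne j i with rfl | hj
      · simp [hφw]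
      · simp [hj]
  choose F hF hFV hFw using hpoint
  intro c
  refine ⟨∑ i, C (c i) * F i, IsHomogeneous.sum _ _ _ fun i _ => (hF i).C_mul _,
    fun p v hv => ?_, fun j => ?_⟩
  · simp [hFV _ p v hv]
  · simp [hFw, Pi.single_apply]
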